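/- arXiv:2404.15066 — 3 statements merged into one kernel-verified Lean document; each statement's English description precedes it below -/
import Mathlib

section
/- Let g, r, d be integers with r ≥ 1, 2r ≤ d ≤ g - 1, d = d_max(g,r), and suppose r satisfies condition (1.1). Unless all of the following hold simultaneously — ρ(g,r,d) = -(r+1), r + 1 is odd, g is not a perfect square, and r = ⌊√g⌋ — one has the inequality (2r+1)·⌊(-ρ(g,r,d)+1)/2⌋ - ⌊(-ρ(g,r,d))/2⌋ ≤ g. -/
/-- The Brill--Noether number `ρ(g,r,d) = g - (r+1)(g-d+r)`. -/
def rho (g r d : ℤ) : ℤ := g - (r + 1) * (g - d + r)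

/-- `d_max(g,r) = r + ⌈gr/(r+1)⌉ - 1`. -/
def dmax (g r : ℤ) : ℤ := r + ⌈(g : ℚ) * r / (r + 1)⌉ - 1

/-- Condition (1.1) on the pair `(g,r)`. -/
def cond11 (g r : ℤ) : Prop :=
  let s : ℤ := (Nat.sqrt g.toNat : ℤ)
  1 ≤ r ∧ r ≤ (if s ^ 2 + s ≤ g then (if s * s = g then s - 1 else s) else s - 1)

theorem dmax_eq (g r : ℤ) (hr : 0 ≤ r) : dmax g r = r + (g - g / (r + 1)) - 1 := by
  have hpos : (0 : ℚ) < (r : ℚ) + 1 := by exact_mod_cast Int.lt_add_one_of_le hr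
  have hceil : ⌈(g : ℚ) * r / (r + 1)⌉ = g - g / (r + 1) := by
    have hfloor : ⌊(g : ℚ) / ((r + 1 : ℤ) : ℚ)⌋ = g / (r + 1) := by
      rw [Int.floor_div_cast_of_nonneg (by omega), Int.floor_intCast]
    have hsplit : (g : ℚ) * r / (r + 1) = (g : ℚ) + -((g : ℚ) / ((r + 1 : ℤ) : ℚ)) := by
      push_cast
      field_simp
      ring
    rw [hsplit, Int.ceil_intCast_add, Int.ceil_neg, hfloor]
    ring
  rw [dmax, hceil]

theorem neg_rho_dmax (g r : ℤ) (hr : 0 ≤ r) :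
    -(rho g r (dmax g r)) = r + 1 - g % (r + 1) := by
  rw [dmax_eq g r hr, rho]
  linear_combination Int.emod_add_mul_ediv g (r + 1)

theorem floor_combination_le_of_bound {n q p : ℤ} (hn : 0 ≤ n) (hp : p ≤ q + 1)
    (hodd : Odd p → p ≤ q) :
    (2 * n - 1) * ((p + 1) / 2) - p / 2 ≤ n * q + (n - p) := by
  rcases Int.even_or_odd' p with ⟨t, rfl | rfl⟩
  · rw [show (2 * t + 1) / 2 = t by omega, show 2 * t / 2 = t by omega]
    nlinarith [mul_le_mul_of_nonneg_left hp hn]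
  · have hq := hodd ⟨t, rfl⟩
    rw [show (2 * t + 1 + 1) / 2 = t + 1 by omega, show (2 * t + 1) / 2 = t by omega]
    nlinarith [mul_le_mul_of_nonneg_left hq hn]

theorem stmt3 (g r d : ℤ) (hr : 1 ≤ r) (hd1 : 2 * r ≤ d) (hd2 : d ≤ g - 1)
    (hdmax : d = dmax g r) (hcond : cond11 g r)
    (hexc : ¬ (rho g r d = -(r + 1) ∧ Odd (r + 1) ∧ ¬ IsSquare g ∧
      r = (Nat.sqrt g.toNat : ℤ))) :
    (2 * r + 1) * ((-(rho g r d) + 1) / 2) - (-(rho g r d)) / 2 ≤ g := by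
  have hg : 0 ≤ g := by omega
  have hn : 0 < r + 1 := by omega
  have hρ : -(rho g r d) = r + 1 - g % (r + 1) := hdmax ▸ neg_rho_dmax g r (by omega)
  have hdiv := Int.emod_add_mul_ediv g (r + 1)
  have hmod := Int.emod_nonneg g hn.ne'
  have hsq : (Nat.sqrt g.toNat : ℤ) * (Nat.sqrt g.toNat : ℤ) ≤ g := by
    have h : ((Nat.sqrt g.toNat * Nat.sqrt g.toNat : ℕ) : ℤ) ≤ (g.toNat : ℤ) := by
      exact_mod_cast Nat.sqrt_le g.toNat
    rwa [Int.toNat_of_nonneg hg, Nat.cast_mul] at h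
  have hsquare : IsSquare g → (Nat.sqrt g.toNat : ℤ) * (Nat.sqrt g.toNat : ℤ) = g := by
    rintro ⟨a, rfl⟩
    have h : (a * a).toNat = a.natAbs * a.natAbs := by
      rw [← Int.natAbs_mul_self, Int.toNat_natCast]
    rw [h, Nat.sqrt_eq, Int.natAbs_mul_self']
  have key : r + 1 ≤ g / (r + 1) ∨
      (r ≤ g / (r + 1) ∧ r = (Nat.sqrt g.toNat : ℤ) ∧ ¬ IsSquare g) := by
    simp only [cond11] at hcond
    have hsmall : r ≤ (Nat.sqrt g.toNat : ℤ) - 1 → r + 1 ≤ g / (r + 1) := fun h =>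
      (Int.le_ediv_iff_mul_le hn).2 (by nlinarith)
    obtain ⟨-, h⟩ := hcond
    split_ifs at h with h1 h2
    · exact .inl (hsmall h)
    · rcases h.lt_or_eq with h3 | h3
      · exact .inl (hsmall (by omega))
      · exact .inr ⟨(Int.le_ediv_iff_mul_le hn).2 (by rw [h3]; linarith), h3,
          fun h4 => h2 (hsquare h4)⟩
    · exact .inl (hsmall h)
  have main := floor_combination_le_of_bound (n := r + 1) (q := g / (r + 1))
    (p := -(rho g r d)) hn.le (by omega) (by
      intro hodd
      rcases key with h | ⟨h, hs, hns⟩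
      · omega
      · by_contra hlt
        have hp : -(rho g r d) = r + 1 := by omega
        exact hexc ⟨by omega, hp ▸ hodd, hns, hs⟩)
  rw [show 2 * (r + 1) - 1 = 2 * r + 1 by ring] at main
  linarith
end

section
/- For every odd integer n ≥ 3, set g = n² - n and r = n - 1. Then r = ⌊√g⌋, ρ(g, r, d_max(g,r)) = -n, and (2r+1)·⌊(n+1)/2⌋ - ⌊n/2⌋ = n² > g; in particular the inequality (2r+1)·⌊(-ρ+1)/2⌋ - ⌊-ρ/2⌋ ≤ g (condition (*)) fails for ρ = ρ(g, r, d_max(g,r)). -/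
theorem stmt5 (n : ℤ) (hn : 3 ≤ n) (hodd : Odd n) (g r : ℤ)
    (hg : g = n ^ 2 - n) (hr : r = n - 1) :
    r = (Nat.sqrt g.toNat : ℤ) ∧
    rho g r (dmax g r) = -n ∧
    (2 * r + 1) * ((n + 1) / 2) - n / 2 = n ^ 2 ∧ n ^ 2 > g ∧
    ¬ ((2 * r + 1) * ((-(rho g r (dmax g r)) + 1) / 2)
        - (-(rho g r (dmax g r))) / 2 ≤ g) := by
  subst hg hr
  have hceil : dmax (n ^ 2 - n) (n - 1) = n ^ 2 - n - 1 := by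
    have hn0 : (n : ℚ) ≠ 0 := by
      have : n ≠ 0 := by omega
      exact_mod_cast this
    have hq : ((n ^ 2 - n : ℤ) : ℚ) * (n - 1 : ℤ) / ((n - 1 : ℤ) + 1) = ((n - 1) ^ 2 : ℤ) := by
      push_cast
      rw [sub_add_cancel]
      field_simp
    rw [dmax, hq, Int.ceil_intCast]
    ring
  have hrho : rho (n ^ 2 - n) (n - 1) (dmax (n ^ 2 - n) (n - 1)) = -n := by
    rw [hceil, rho]
    ring
  have hsq : (2 * (n - 1) + 1) * ((n + 1) / 2) - n / 2 = n ^ 2 := by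
    obtain ⟨k, rfl⟩ := hodd
    have h₁ : (2 * k + 1 + 1) / 2 = k + 1 := by omega
    have h₂ : (2 * k + 1) / 2 = k := by omega
    rw [h₁, h₂]
    ring
  refine ⟨?_, hrho, hsq, by linarith, ?_⟩
  · lift n to ℕ using by omega
    obtain ⟨m, rfl⟩ : ∃ m, n = m + 1 := ⟨n - 1, by omega⟩
    have hg : (((m + 1 : ℕ) : ℤ) ^ 2 - ((m + 1 : ℕ) : ℤ)).toNat = m * m + m := by
      have : ((m + 1 : ℕ) : ℤ) ^ 2 - ((m + 1 : ℕ) : ℤ) = ((m * m + m : ℕ) : ℤ) := by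
        push_cast
        ring
      rw [this, Int.toNat_natCast]
    rw [hg, Nat.sqrt_add_eq m (by omega)]
    push_cast
    ring
  · rw [hrho, neg_neg, hsq]
    linarith
end

section
/- Let g, r, d be integers with g ≥ 8, r ≥ 2, 2r ≤ d ≤ g - 1, suppose r satisfies condition (1.1), and suppose -(r-1) ≤ ρ(g,r,d) ≤ -1. Then g - 3r - 3 - ρ(g,r,d) ≥ 0 and d - 3r - ρ(g,r,d) ≥ 0. -/
theorem cond11.sq_add_self_le {g r : ℤ} (hg : 0 ≤ g) (h : cond11 g r) : r ^ 2 + r ≤ g := by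
  obtain ⟨hr, h⟩ := h
  have hs : (Nat.sqrt g.toNat : ℤ) ^ 2 ≤ g := by
    have hle : (Nat.sqrt g.toNat : ℤ) ^ 2 ≤ (g.toNat : ℤ) := by
      exact_mod_cast Nat.sqrt_le' g.toNat
    rwa [Int.toNat_of_nonneg hg] at hle
  split_ifs at h <;> nlinarith

theorem stmt14 (g r d : ℤ) (hg : 8 ≤ g) (hr : 2 ≤ r) (hd1 : 2 * r ≤ d)
    (hd2 : d ≤ g - 1) (hcond : cond11 g r)
    (h1 : -(r - 1) ≤ rho g r d) (h2 : rho g r d ≤ -1) :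
    0 ≤ g - 3 * r - 3 - rho g r d ∧ 0 ≤ d - 3 * r - rho g r d := by
  have hgr : r ^ 2 + r ≤ g := hcond.sq_add_self_le (by lia)
  constructor
  · obtain rfl | h3 : r = 2 ∨ 3 ≤ r := by lia
    · lia
    · nlinarith
  · have hprod : 0 ≤ r * (g - d + r - 2) := mul_nonneg (by lia) (by lia)
    unfold rho
    linarith
end
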